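/- Impossibility of the G-DS constraints on the deterministic Z-interference channel (Example 2). There do not exist jointly distributed finite-valued random variables U₀, V₀, U₁, V₁, U₂, V₂ and deterministic functions x₁ (of (u₀,v₀,u₁,v₁)) and x₂ (of (u₀,v₀,u₂,v₂)) with values in {0,1} such that, defining X₁ = x₁(U₀,V₀,U₁,V₁), X₂ = x₂(U₀,V₀,U₂,V₂), Y₁ = X₁ and Y₂ = X₁ ⊕ X₂ (addition mod 2), all five of the following hold simultaneously (entropies in bits): (1) I(U₀,U₁,U₂; V₀,V₁,V₂) = 0; (2) I(U₁,V₁; U₂,V₂ | U₀,V₀) = 0; (3) I(U₀,U₁,U₂; Y₁) = 1; (4) I(V₀,V₁,V₂; Y₂) = 1; (5) I(U₁,U₂; Y₁ | U₀) = 1. -/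

import Mathlib

open MeasureTheory

/-- Shannon entropy (in bits) of a finite-valued random variable `X` on `(Ω, μ)`:
`H(X) = −Σ_a P(X = a) · log₂ P(X = a)` (with the convention `0 · log₂ 0 = 0`). -/
noncomputable def entH {Ω : Type*} [MeasurableSpace Ω] {α : Type*} [Fintype α]
    (μ : Measure Ω) (X : Ω → α) : ℝ :=
  -∑ a : α, (μ (X ⁻¹' {a})).toReal * Real.logb 2 (μ (X ⁻¹' {a})).toReal

/-- Conditional entropy `H(X | Y) = H(X, Y) − H(Y)`. -/
noncomputable def condEntH {Ω : Type*} [MeasurableSpace Ω] {α β : Type*} [Fintype α] [Fintype β]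
    (μ : Measure Ω) (X : Ω → α) (Y : Ω → β) : ℝ :=
  entH μ (fun ω => (X ω, Y ω)) - entH μ Y

/-- Mutual information `I(X; Y) = H(X) + H(Y) − H(X, Y)`. -/
noncomputable def miH {Ω : Type*} [MeasurableSpace Ω] {α β : Type*} [Fintype α] [Fintype β]
    (μ : Measure Ω) (X : Ω → α) (Y : Ω → β) : ℝ :=
  entH μ X + entH μ Y - entH μ (fun ω => (X ω, Y ω))

/-- Conditional mutual information `I(X; Y | Z) = H(X|Z) + H(Y|Z) − H(X,Y|Z)`. -/
noncomputable def cmiH {Ω : Type*} [MeasurableSpace Ω] {α β γ : Type*}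
    [Fintype α] [Fintype β] [Fintype γ]
    (μ : Measure Ω) (X : Ω → α) (Y : Ω → β) (Z : Ω → γ) : ℝ :=
  condEntH μ X Z + condEntH μ Y Z - condEntH μ (fun ω => (X ω, Y ω)) Z

section EntropyLemmas

variable {Ω α β γ : Type*} [MeasurableSpace Ω] {μ : Measure Ω}

/-- The law of `φ ∘ Z` is obtained by summing the law of `Z` over the fibres of `φ`. -/
lemma measureReal_comp_preimage_singleton [IsFiniteMeasure μ] [Fintype γ] [DecidableEq α]
    [MeasurableSpace γ] [MeasurableSingletonClass γ] {Z : Ω → γ} (hZ : Measurable Z)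
    (φ : γ → α) (a : α) :
    μ.real ((fun ω => φ (Z ω)) ⁻¹' {a}) = ∑ z with φ z = a, μ.real (Z ⁻¹' {z}) := by
  rw [sum_measureReal_preimage_singleton _ fun z _ => hZ (measurableSet_singleton z)]
  congr 1
  ext ω
  simp

lemma sum_measureReal_comp_mul [IsFiniteMeasure μ] [Fintype γ] [Fintype α]
    [MeasurableSpace γ] [MeasurableSingletonClass γ] {Z : Ω → γ} (hZ : Measurable Z)
    (φ : γ → α) (f : α → ℝ) :
    ∑ a, μ.real ((fun ω => φ (Z ω)) ⁻¹' {a}) * f a = ∑ z, μ.real (Z ⁻¹' {z}) * f (φ z) := by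
  classical
  rw [← Finset.sum_fiberwise Finset.univ φ]
  refine Finset.sum_congr rfl fun a _ => ?_
  rw [measureReal_comp_preimage_singleton hZ, Finset.sum_mul]
  refine Finset.sum_congr rfl fun z hz => ?_
  rw [(Finset.mem_filter.1 hz).2]

/-- The entropy of `φ ∘ Z` as an expectation over the law of `Z`. -/
lemma entH_comp [IsFiniteMeasure μ] [Fintype γ] [Fintype α]
    [MeasurableSpace γ] [MeasurableSingletonClass γ] {Z : Ω → γ} (hZ : Measurable Z)
    (φ : γ → α) :
    entH μ (fun ω => φ (Z ω)) = -∑ z, μ.real (Z ⁻¹' {z}) *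
      Real.logb 2 (μ.real ((fun ω => φ (Z ω)) ⁻¹' {φ z})) :=
  congrArg Neg.neg (sum_measureReal_comp_mul hZ φ _)

lemma measureReal_preimage_le_comp [IsFiniteMeasure μ] (Z : Ω → γ) (φ : γ → α) (z : γ) :
    μ.real (Z ⁻¹' {z}) ≤ μ.real ((fun ω => φ (Z ω)) ⁻¹' {φ z}) :=
  measureReal_mono fun ω (hω : Z ω = z) => congrArg φ hω

lemma measureReal_mul_logb_le_comp [IsFiniteMeasure μ] (Z : Ω → γ) (φ : γ → α) (z : γ) :
    μ.real (Z ⁻¹' {z}) * Real.logb 2 (μ.real (Z ⁻¹' {z})) ≤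
      μ.real (Z ⁻¹' {z}) * Real.logb 2 (μ.real ((fun ω => φ (Z ω)) ⁻¹' {φ z})) := by
  rcases (measureReal_nonneg (μ := μ) (s := Z ⁻¹' {z})).eq_or_lt with h | h
  · simp [← h]
  · exact mul_le_mul_of_nonneg_left (Real.logb_le_logb_of_le one_lt_two h
      (measureReal_preimage_le_comp Z φ z)) h.le

lemma entH_comp_le [IsFiniteMeasure μ] [Fintype γ] [Fintype α]
    [MeasurableSpace γ] [MeasurableSingletonClass γ] {Z : Ω → γ} (hZ : Measurable Z)
    (φ : γ → α) : entH μ (fun ω => φ (Z ω)) ≤ entH μ Z := by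
  rw [entH_comp hZ]
  exact neg_le_neg (Finset.sum_le_sum fun z _ => measureReal_mul_logb_le_comp Z φ z)

/-- If `φ` loses no entropy, then it is injective on the support of `Z`. -/
lemma measureReal_comp_eq_of_entH_le [IsFiniteMeasure μ] [Fintype γ] [Fintype α]
    [MeasurableSpace γ] [MeasurableSingletonClass γ] {Z : Ω → γ} (hZ : Measurable Z)
    (φ : γ → α) (h : entH μ Z ≤ entH μ (fun ω => φ (Z ω))) (z : γ)
    (hz : 0 < μ.real (Z ⁻¹' {z})) :
    μ.real ((fun ω => φ (Z ω)) ⁻¹' {φ z}) = μ.real (Z ⁻¹' {z}) := by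
  have hsum := le_antisymm h (entH_comp_le hZ φ)
  rw [entH_comp hZ] at hsum
  have hterm := (Finset.sum_eq_sum_iff_of_le
    fun z _ => measureReal_mul_logb_le_comp (μ := μ) Z φ z).1 (neg_injective hsum) z
    (Finset.mem_univ z)
  exact (Real.logb_injOn_pos one_lt_two hz (hz.trans_le (measureReal_preimage_le_comp Z φ z))
    (mul_left_cancel₀ hz.ne' hterm)).symm

/-- If `φ` is injective on the support of `Z`, then it loses no entropy. -/
lemma entH_comp_eq [IsFiniteMeasure μ] [Fintype γ] [Fintype α]
    [MeasurableSpace γ] [MeasurableSingletonClass γ] {Z : Ω → γ} (hZ : Measurable Z)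
    (φ : γ → α) (h : ∀ z, 0 < μ.real (Z ⁻¹' {z}) →
      μ.real ((fun ω => φ (Z ω)) ⁻¹' {φ z}) = μ.real (Z ⁻¹' {z})) :
    entH μ (fun ω => φ (Z ω)) = entH μ Z := by
  rw [entH_comp hZ]
  refine congrArg Neg.neg (Finset.sum_congr rfl fun z _ => ?_)
  rcases (measureReal_nonneg (μ := μ) (s := Z ⁻¹' {z})).eq_or_lt with hz | hz
  · rw [← Measure.real, ← hz]
    simp
  · rw [h z hz, Measure.real]

lemma sub_le_mul_logb_sub_logb {p q : ℝ} (hp : 0 ≤ p) (hq : 0 ≤ q) (h : 0 < p → 0 < q) :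
    p - q ≤ Real.log 2 * (p * (Real.logb 2 p - Real.logb 2 q)) := by
  have h2 : Real.log 2 ≠ 0 := (Real.log_pos one_lt_two).ne'
  rcases hp.eq_or_lt with rfl | hp
  · simpa using hq
  · have hq' := h hp
    have hlog := Real.log_le_sub_one_of_pos (div_pos hq' hp)
    rw [Real.log_div hq'.ne' hp.ne'] at hlog
    have hpq : p * (q / p) = q := by field_simp
    have : Real.log 2 * (p * (Real.logb 2 p - Real.logb 2 q)) =
        p * (Real.log p - Real.log q) := by
      simp only [Real.logb]
      field_simp
    rw [this]
    nlinarith [mul_le_mul_of_nonneg_left hlog hp.le]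

lemma pos_of_mul_logb_sub_logb_eq {p q : ℝ} (hp : 0 ≤ p) (hq : 0 < q)
    (h : p - q = Real.log 2 * (p * (Real.logb 2 p - Real.logb 2 q))) : 0 < p := by
  rcases hp.eq_or_lt with rfl | hp
  · simp at h
    exact absurd h hq.ne'
  · exact hp

/-- Gibbs' inequality. -/
lemma sum_mul_logb_sub_logb_nonneg [Fintype α] {p q : α → ℝ} (hp : ∀ a, 0 ≤ p a)
    (hq : ∀ a, 0 ≤ q a) (h : ∀ a, 0 < p a → 0 < q a) (hsum : ∑ a, q a ≤ ∑ a, p a) :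
    0 ≤ ∑ a, p a * (Real.logb 2 (p a) - Real.logb 2 (q a)) := by
  have hle := Finset.sum_le_sum fun a (_ : a ∈ Finset.univ) =>
    sub_le_mul_logb_sub_logb (hp a) (hq a) (h a)
  rw [Finset.sum_sub_distrib, ← Finset.mul_sum] at hle
  exact nonneg_of_mul_nonneg_right (le_trans (sub_nonneg.2 hsum) hle) (Real.log_pos one_lt_two)

/-- In the equality case of Gibbs' inequality the supports agree. -/
lemma pos_of_sum_mul_logb_sub_logb_eq_zero [Fintype α] {p q : α → ℝ} (hp : ∀ a, 0 ≤ p a)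
    (hq : ∀ a, 0 ≤ q a) (h : ∀ a, 0 < p a → 0 < q a) (hsum : ∑ a, q a = ∑ a, p a)
    (hzero : ∑ a, p a * (Real.logb 2 (p a) - Real.logb 2 (q a)) = 0) (a : α) (ha : 0 < q a) :
    0 < p a := by
  refine pos_of_mul_logb_sub_logb_eq (hp a) ha ?_
  refine (Finset.sum_eq_sum_iff_of_le fun a (_ : a ∈ Finset.univ) =>
    sub_le_mul_logb_sub_logb (hp a) (hq a) (h a)).1 ?_ a (Finset.mem_univ a)
  rw [Finset.sum_sub_distrib, ← Finset.mul_sum, hzero, hsum, sub_self, mul_zero]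

lemma sum_measureReal_preimage_singleton_univ [IsProbabilityMeasure μ] [Fintype α]
    [MeasurableSpace α] [MeasurableSingletonClass α] {X : Ω → α} (hX : Measurable X) :
    ∑ a, μ.real (X ⁻¹' {a}) = 1 := by
  rw [sum_measureReal_preimage_singleton _ fun a _ => hX (measurableSet_singleton a)]
  simp

lemma entH_le_logb_card [IsProbabilityMeasure μ] [Fintype α] [Nonempty α]
    [MeasurableSpace α] [MeasurableSingletonClass α] {X : Ω → α} (hX : Measurable X) :
    entH μ X ≤ Real.logb 2 (Fintype.card α) := by
  have hcard : (0 : ℝ) < Fintype.card α := by exact_mod_cast Fintype.card_pos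
  have hsum := sum_measureReal_preimage_singleton_univ (μ := μ) hX
  have hgibbs := sum_mul_logb_sub_logb_nonneg (p := fun a => μ.real (X ⁻¹' {a}))
    (q := fun _ => (Fintype.card α : ℝ)⁻¹) (fun _ => measureReal_nonneg)
    (fun _ => (inv_pos.2 hcard).le) (fun _ _ => inv_pos.2 hcard) (by
      rw [hsum]
      simp [hcard.ne'])
  simp only [mul_sub, Finset.sum_sub_distrib, ← Finset.sum_mul, hsum, Real.logb_inv] at hgibbs
  simp only [entH]
  simp only [Measure.real] at hgibbs
  linarith

/-- A vanishing conditional mutual information `I(X; Y | Z)` forces the support of `(X, Y)` to be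
a product given `Z`. -/
lemma pos_of_cmiH_eq_zero [IsProbabilityMeasure μ] [Fintype α] [Fintype β] [Fintype γ]
    [MeasurableSpace α] [MeasurableSingletonClass α] [MeasurableSpace β]
    [MeasurableSingletonClass β] [MeasurableSpace γ] [MeasurableSingletonClass γ]
    {X : Ω → α} {Y : Ω → β} {Z : Ω → γ} (hX : Measurable X) (hY : Measurable Y)
    (hZ : Measurable Z) (h : cmiH μ X Y Z = 0) (x : α) (y : β) (z : γ)
    (hx : 0 < μ.real ((fun ω => (X ω, Z ω)) ⁻¹' {(x, z)}))
    (hy : 0 < μ.real ((fun ω => (Y ω, Z ω)) ⁻¹' {(y, z)})) :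
    0 < μ.real ((fun ω => ((X ω, Y ω), Z ω)) ⁻¹' {((x, y), z)}) := by
  classical
  have hT : Measurable fun ω => ((X ω, Y ω), Z ω) := (hX.prodMk hY).prodMk hZ
  have eXZ := entH_comp (μ := μ) hT fun t => (t.1.1, t.2)
  have eYZ := entH_comp (μ := μ) hT fun t => (t.1.2, t.2)
  have eZ := entH_comp (μ := μ) hT fun t => t.2
  have eT := entH_comp (μ := μ) hT fun t => t
  have lXZ := measureReal_preimage_le_comp (μ := μ) (fun ω => ((X ω, Y ω), Z ω))
    fun t => (t.1.1, t.2)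
  have lYZ := measureReal_preimage_le_comp (μ := μ) (fun ω => ((X ω, Y ω), Z ω))
    fun t => (t.1.2, t.2)
  have lZ := measureReal_preimage_le_comp (μ := μ) (fun ω => (X ω, Z ω)) fun t => t.2
  have sXZ (z : γ) : ∑ x, μ.real ((fun ω => (X ω, Z ω)) ⁻¹' {(x, z)}) = μ.real (Z ⁻¹' {z}) := by
    rw [measureReal_comp_preimage_singleton (hX.prodMk hZ) (fun t => t.2), Finset.sum_filter,
      Fintype.sum_prod_type]
    simp
  have sYZ (z : γ) : ∑ y, μ.real ((fun ω => (Y ω, Z ω)) ⁻¹' {(y, z)}) = μ.real (Z ⁻¹' {z}) := by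
    rw [measureReal_comp_preimage_singleton (hY.prodMk hZ) (fun t => t.2), Finset.sum_filter,
      Fintype.sum_prod_type]
    simp
  set p : (α × β) × γ → ℝ := fun t => μ.real ((fun ω => ((X ω, Y ω), Z ω)) ⁻¹' {t})
  set q : (α × β) × γ → ℝ := fun t => μ.real ((fun ω => (X ω, Z ω)) ⁻¹' {(t.1.1, t.2)}) *
    μ.real ((fun ω => (Y ω, Z ω)) ⁻¹' {(t.1.2, t.2)}) / μ.real (Z ⁻¹' {t.2}) with hq
  have pos {t : (α × β) × γ} (ht : 0 < p t) :
      0 < μ.real ((fun ω => (X ω, Z ω)) ⁻¹' {(t.1.1, t.2)}) ∧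
      0 < μ.real ((fun ω => (Y ω, Z ω)) ⁻¹' {(t.1.2, t.2)}) ∧ 0 < μ.real (Z ⁻¹' {t.2}) :=
    ⟨ht.trans_le (lXZ t), ht.trans_le (lYZ t),
      (ht.trans_le (lXZ t)).trans_le (lZ (t.1.1, t.2))⟩
  refine pos_of_sum_mul_logb_sub_logb_eq_zero (p := p) (q := q) (fun _ => measureReal_nonneg)
    (fun _ => by positivity) (fun t ht => ?_) ?_ ?_ ((x, y), z) ?_
  · obtain ⟨h1, h2, h3⟩ := pos ht
    exact div_pos (mul_pos h1 h2) h3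
  · rw [sum_measureReal_preimage_singleton_univ hT,
      ← sum_measureReal_preimage_singleton_univ (μ := μ) hZ, Fintype.sum_prod_type_right]
    refine Finset.sum_congr rfl fun z _ => ?_
    simp only [hq]
    rw [← Finset.sum_div, Fintype.sum_prod_type]
    simp only [← Finset.mul_sum, ← Finset.sum_mul, sXZ, sYZ]
    exact mul_self_div_self _
  · have key : ∀ t, p t * (Real.logb 2 (p t) - Real.logb 2 (q t)) =
        p t * Real.logb 2 (p t)
        - p t * Real.logb 2 (μ.real ((fun ω => (X ω, Z ω)) ⁻¹' {(t.1.1, t.2)}))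
        - p t * Real.logb 2 (μ.real ((fun ω => (Y ω, Z ω)) ⁻¹' {(t.1.2, t.2)}))
        + p t * Real.logb 2 (μ.real (Z ⁻¹' {t.2})) := by
      intro t
      rcases (measureReal_nonneg : 0 ≤ p t).eq_or_lt with ht | ht
      · rw [show p t = 0 from ht.symm]
        simp
      · obtain ⟨h1, h2, h3⟩ := pos ht
        rw [hq, Real.logb_div (mul_pos h1 h2).ne' h3.ne', Real.logb_mul h1.ne' h2.ne']
        ring
    rw [Finset.sum_congr rfl fun t _ => key t, Finset.sum_add_distrib, Finset.sum_sub_distrib,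
      Finset.sum_sub_distrib]
    simp only [cmiH, condEntH] at h
    linarith
  · exact div_pos (mul_pos hx hy) (hx.trans_le (lZ (x, z)))

lemma miH_eq_cmiH_const [IsProbabilityMeasure μ] [Fintype α] [Fintype β]
    [MeasurableSpace α] [MeasurableSingletonClass α] [MeasurableSpace β]
    [MeasurableSingletonClass β] {X : Ω → α} {Y : Ω → β} (hX : Measurable X)
    (hY : Measurable Y) : miH μ X Y = cmiH μ X Y fun _ => () := by
  have hconst : entH μ (fun _ : Ω => ()) = 0 := by simp [entH]
  have e1 := entH_comp_eq (μ := μ) hX (fun a => (a, ())) fun a _ => by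
    congr 1
    ext
    simp
  have e2 := entH_comp_eq (μ := μ) hY (fun a => (a, ())) fun a _ => by
    congr 1
    ext
    simp
  have e3 := entH_comp_eq (μ := μ) (hX.prodMk hY) (fun a => (a, ())) fun a _ => by
    congr 1
    ext
    simp
  simp only [miH, cmiH, condEntH]
  linarith

/-- Independent variables have a product support. -/
lemma pos_of_miH_eq_zero [IsProbabilityMeasure μ] [Fintype α] [Fintype β]
    [MeasurableSpace α] [MeasurableSingletonClass α] [MeasurableSpace β]
    [MeasurableSingletonClass β] {X : Ω → α} {Y : Ω → β} (hX : Measurable X)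
    (hY : Measurable Y) (h : miH μ X Y = 0) (x : α) (y : β)
    (hx : 0 < μ.real (X ⁻¹' {x})) (hy : 0 < μ.real (Y ⁻¹' {y})) :
    0 < μ.real ((fun ω => (X ω, Y ω)) ⁻¹' {(x, y)}) := by
  rw [miH_eq_cmiH_const hX hY] at h
  refine (pos_of_cmiH_eq_zero hX hY measurable_const h x y () (hx.trans_le ?_)
    (hy.trans_le ?_)).trans_le ?_
  · exact measureReal_preimage_le_comp X (fun a => (a, ())) x
  · exact measureReal_preimage_le_comp Y (fun a => (a, ())) y
  · exact measureReal_preimage_le_comp (fun ω => ((X ω, Y ω), ())) Prod.fst ((x, y), ())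

/-- Two distinct values of `Y` cannot both have positive probability jointly with `X = x` when
`H(X, Y) ≤ H(X)`. -/
lemma eq_of_entH_prod_le [IsFiniteMeasure μ] [Fintype α] [Fintype β]
    [MeasurableSpace α] [MeasurableSingletonClass α] [MeasurableSpace β]
    [MeasurableSingletonClass β] {X : Ω → α} {Y : Ω → β} (hX : Measurable X)
    (hY : Measurable Y) (h : entH μ (fun ω => (X ω, Y ω)) ≤ entH μ X) {x : α} {y y' : β}
    (hy : 0 < μ.real ((fun ω => (X ω, Y ω)) ⁻¹' {(x, y)}))
    (hy' : 0 < μ.real ((fun ω => (X ω, Y ω)) ⁻¹' {(x, y')})) : y = y' := by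
  by_contra hne
  have heq : μ.real (X ⁻¹' {x}) = _ :=
    measureReal_comp_eq_of_entH_le (hX.prodMk hY) Prod.fst h (x, y) hy
  have hle : μ.real ((fun ω => (X ω, Y ω)) ⁻¹' {(x, y)} ∪ (fun ω => (X ω, Y ω)) ⁻¹' {(x, y')}) ≤
      μ.real (X ⁻¹' {x}) := by
    refine measureReal_mono ?_
    rintro ω (hω | hω) <;> exact congrArg Prod.fst hω
  rw [measureReal_union (Disjoint.preimage _ (by simpa using hne))
    ((hX.prodMk hY) (measurableSet_singleton _))] at hle
  linarith

/-- If `I(X; Y)` is the logarithm of the number of values of `Y`, then `Y` is determined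
by `X` on the support. -/
lemma eq_of_miH_eq_logb_card [IsProbabilityMeasure μ] [Fintype α] [Fintype β] [Nonempty β]
    [MeasurableSpace α] [MeasurableSingletonClass α] [MeasurableSpace β]
    [MeasurableSingletonClass β] {X : Ω → α} {Y : Ω → β} (hX : Measurable X)
    (hY : Measurable Y) (h : miH μ X Y = Real.logb 2 (Fintype.card β)) {x : α} {y y' : β}
    (hy : 0 < μ.real ((fun ω => (X ω, Y ω)) ⁻¹' {(x, y)}))
    (hy' : 0 < μ.real ((fun ω => (X ω, Y ω)) ⁻¹' {(x, y')})) : y = y' := by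
  refine eq_of_entH_prod_le hX hY ?_ hy hy'
  have := entH_le_logb_card (μ := μ) hY
  rw [miH] at h
  linarith

/-- A variable `Y` with `I(X; Y | Z) > 0` is not determined by `Z`. -/
lemma exists_ne_of_cmiH_pos [IsFiniteMeasure μ] [Fintype α] [Fintype β] [Fintype γ]
    [MeasurableSpace α] [MeasurableSingletonClass α] [MeasurableSpace β]
    [MeasurableSingletonClass β] [MeasurableSpace γ] [MeasurableSingletonClass γ]
    {X : Ω → α} {Y : Ω → β} {Z : Ω → γ} (hX : Measurable X) (hY : Measurable Y)
    (hZ : Measurable Z) (h : 0 < cmiH μ X Y Z) :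
    ∃ z y y', y ≠ y' ∧ 0 < μ.real ((fun ω => (Y ω, Z ω)) ⁻¹' {(y, z)}) ∧
      0 < μ.real ((fun ω => (Y ω, Z ω)) ⁻¹' {(y', z)}) := by
  classical
  by_contra! hcon
  have e1 : entH μ Z = entH μ fun ω => (Y ω, Z ω) := by
    refine entH_comp_eq (hY.prodMk hZ) Prod.snd ?_
    rintro ⟨y, z⟩ hy
    rw [measureReal_comp_preimage_singleton (hY.prodMk hZ) Prod.snd, Finset.sum_filter,
      Fintype.sum_prod_type]
    simp only [Finset.sum_ite_eq', Finset.mem_univ, if_true]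
    refine Finset.sum_eq_single y (fun y' _ hne => ?_) (by simp)
    exact le_antisymm (hcon z y y' hne.symm hy) measureReal_nonneg
  have e2 := entH_comp_le (μ := μ) ((hX.prodMk hY).prodMk hZ) fun t => (t.1.1, t.2)
  simp only [cmiH, condEntH] at h
  linarith

/-- An event of positive probability contains an outcome at which `W` takes a value of positive
probability. -/
lemma exists_mem_measureReal_preimage_pos [IsFiniteMeasure μ] [Finite γ] (W : Ω → γ) {E : Set Ω}
    (hE : 0 < μ.real E) : ∃ ω ∈ E, 0 < μ.real (W ⁻¹' {W ω}) := by
  by_contra! hcon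
  have hnull : μ (⋃ c : {c : γ // μ (W ⁻¹' {c}) = 0}, W ⁻¹' {c.1}) = 0 :=
    measure_iUnion_null fun c => c.2
  have hsub : E ⊆ ⋃ c : {c : γ // μ (W ⁻¹' {c}) = 0}, W ⁻¹' {c.1} := fun ω hω =>
    Set.mem_iUnion.2 ⟨⟨W ω, (measureReal_eq_zero_iff).1
      (le_antisymm (hcon ω hω) measureReal_nonneg)⟩, rfl⟩
  exact hE.ne' ((measureReal_eq_zero_iff).2 (measure_mono_null hsub hnull))

end EntropyLemmas

/-- Impossibility of the G-DS constraints on the deterministic Z-interference channel: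
for jointly distributed finite-valued `U₀,V₀,U₁,V₁,U₂,V₂` and deterministic maps
`x₁ : (u₀,v₀,u₁,v₁) ↦ {0,1}` and `x₂ : (u₀,v₀,u₂,v₂) ↦ {0,1}`, setting
`X₁ = x₁(U₀,V₀,U₁,V₁)`, `X₂ = x₂(U₀,V₀,U₂,V₂)`, `Y₁ = X₁` and `Y₂ = X₁ ⊕ X₂`,
the five conditions (1) `I(U₀,U₁,U₂; V₀,V₁,V₂) = 0`, (2) `I(U₁,V₁; U₂,V₂ | U₀,V₀) = 0`,
(3) `I(U₀,U₁,U₂; Y₁) = 1`, (4) `I(V₀,V₁,V₂; Y₂) = 1`, (5) `I(U₁,U₂; Y₁ | U₀) = 1`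
cannot hold simultaneously. -/
theorem stmt_12 {Ω : Type*} [MeasurableSpace Ω] (μ : Measure Ω) [IsProbabilityMeasure μ]
    {A0 A1 A2 B0 B1 B2 : Type*}
    [Fintype A0] [Fintype A1] [Fintype A2] [Fintype B0] [Fintype B1] [Fintype B2]
    [MeasurableSpace A0] [MeasurableSingletonClass A0]
    [MeasurableSpace A1] [MeasurableSingletonClass A1]
    [MeasurableSpace A2] [MeasurableSingletonClass A2]
    [MeasurableSpace B0] [MeasurableSingletonClass B0]
    [MeasurableSpace B1] [MeasurableSingletonClass B1]
    [MeasurableSpace B2] [MeasurableSingletonClass B2]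
    [MeasurableSpace (ZMod 2)] [MeasurableSingletonClass (ZMod 2)]
    (U0 : Ω → A0) (V0 : Ω → B0) (U1 : Ω → A1) (V1 : Ω → B1) (U2 : Ω → A2) (V2 : Ω → B2)
    (hU0 : Measurable U0) (hU1 : Measurable U1) (hU2 : Measurable U2)
    (hV0 : Measurable V0) (hV1 : Measurable V1) (hV2 : Measurable V2)
    (x1 : A0 → B0 → A1 → B1 → ZMod 2) (x2 : A0 → B0 → A2 → B2 → ZMod 2) :
    ¬ (miH μ (fun ω => (U0 ω, U1 ω, U2 ω)) (fun ω => (V0 ω, V1 ω, V2 ω)) = 0 ∧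
       cmiH μ (fun ω => (U1 ω, V1 ω)) (fun ω => (U2 ω, V2 ω)) (fun ω => (U0 ω, V0 ω)) = 0 ∧
       miH μ (fun ω => (U0 ω, U1 ω, U2 ω))
         (fun ω => x1 (U0 ω) (V0 ω) (U1 ω) (V1 ω)) = 1 ∧
       miH μ (fun ω => (V0 ω, V1 ω, V2 ω))
         (fun ω => x1 (U0 ω) (V0 ω) (U1 ω) (V1 ω) + x2 (U0 ω) (V0 ω) (U2 ω) (V2 ω)) = 1 ∧
       cmiH μ (fun ω => (U1 ω, U2 ω))
         (fun ω => x1 (U0 ω) (V0 ω) (U1 ω) (V1 ω)) U0 = 1) := by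
  rintro ⟨hUV, hcond, hUY, hVY, hpos⟩
  have hU : Measurable fun ω => (U0 ω, U1 ω, U2 ω) := hU0.prodMk (hU1.prodMk hU2)
  have hV : Measurable fun ω => (V0 ω, V1 ω, V2 ω) := hV0.prodMk (hV1.prodMk hV2)
  have hW := hU.prodMk hV
  have hY1 : Measurable fun ω => x1 (U0 ω) (V0 ω) (U1 ω) (V1 ω) :=
    (Measurable.of_discrete (f := fun w : (A0 × A1 × A2) × (B0 × B1 × B2) =>
      x1 w.1.1 w.2.1 w.1.2.1 w.2.2.1)).comp hW
  have hY2 : Measurable fun ω =>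
      x1 (U0 ω) (V0 ω) (U1 ω) (V1 ω) + x2 (U0 ω) (V0 ω) (U2 ω) (V2 ω) :=
    (Measurable.of_discrete (f := fun w : (A0 × A1 × A2) × (B0 × B1 × B2) =>
      x1 w.1.1 w.2.1 w.1.2.1 w.2.2.1 + x2 w.1.1 w.2.1 w.1.2.2 w.2.2.2)).comp hW
  have hcard : Real.logb 2 (Fintype.card (ZMod 2)) = 1 := by simp [ZMod.card]
  let W ω := ((U0 ω, U1 ω, U2 ω), (V0 ω, V1 ω, V2 ω))
  let P a0 a1 a2 b0 b1 b2 : ℝ := μ.real (W ⁻¹' {((a0, a1, a2), (b0, b1, b2))})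
  let W₁₂ ω := (((U1 ω, V1 ω), (U2 ω, V2 ω)), (U0 ω, V0 ω))
  let f₁ : (A0 × A1 × A2) × (B0 × B1 × B2) → (A1 × B1) × (A0 × B0) :=
    fun w => ((w.1.2.1, w.2.2.1), (w.1.1, w.2.1))
  let f₂ : (A0 × A1 × A2) × (B0 × B1 × B2) → (A2 × B2) × (A0 × B0) :=
    fun w => ((w.1.2.2, w.2.2.2), (w.1.1, w.2.1))
  let e : ((A1 × B1) × (A2 × B2)) × (A0 × B0) → (A0 × A1 × A2) × (B0 × B1 × B2) :=
    fun w => ((w.2.1, w.1.1.1, w.1.2.1), (w.2.2, w.1.1.2, w.1.2.2))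
  let g₁ : (A0 × A1 × A2) × (B0 × B1 × B2) → (A0 × A1 × A2) × ZMod 2 :=
    fun w => (w.1, x1 w.1.1 w.2.1 w.1.2.1 w.2.2.1)
  let g₂ : (A0 × A1 × A2) × (B0 × B1 × B2) → (B0 × B1 × B2) × ZMod 2 :=
    fun w => (w.2, x1 w.1.1 w.2.1 w.1.2.1 w.2.2.1 + x2 w.1.1 w.2.1 w.1.2.2 w.2.2.2)
  have indep {a0 a1 a2 b0 b1 b2 a0' a1' a2' b0' b1' b2'} (h : 0 < P a0 a1 a2 b0 b1 b2)
      (h' : 0 < P a0' a1' a2' b0' b1' b2') : 0 < P a0 a1 a2 b0' b1' b2' :=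
    pos_of_miH_eq_zero hU hV hUV (a0, a1, a2) (b0', b1', b2')
      (h.trans_le (measureReal_preimage_le_comp W Prod.fst _))
      (h'.trans_le (measureReal_preimage_le_comp W Prod.snd _))
  have condIndep {a0 a1 a2 b0 b1 b2 a1' a2' b1' b2'} (h : 0 < P a0 a1 a2 b0 b1 b2)
      (h' : 0 < P a0 a1' a2' b0 b1' b2') : 0 < P a0 a1 a2' b0 b1 b2' :=
    (pos_of_cmiH_eq_zero (hU1.prodMk hV1) (hU2.prodMk hV2) (hU0.prodMk hV0) hcond
      (a1, b1) (a2', b2') (a0, b0)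
      (h.trans_le (measureReal_preimage_le_comp W f₁ _))
      (h'.trans_le (measureReal_preimage_le_comp W f₂ _))).trans_le
      (measureReal_preimage_le_comp W₁₂ e (((a1, b1), (a2', b2')), (a0, b0)))
  have detU {a0 a1 a2 b0 b1 b2 b0' b1' b2'} (h : 0 < P a0 a1 a2 b0 b1 b2)
      (h' : 0 < P a0 a1 a2 b0' b1' b2') : x1 a0 b0 a1 b1 = x1 a0 b0' a1 b1' :=
    eq_of_miH_eq_logb_card hU hY1 (hUY.trans hcard.symm) (x := (a0, a1, a2))
      (h.trans_le (measureReal_preimage_le_comp W g₁ _))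
      (h'.trans_le (measureReal_preimage_le_comp W g₁ _))
  have detV {a0 a1 a2 b0 b1 b2 a0' a1' a2'} (h : 0 < P a0 a1 a2 b0 b1 b2)
      (h' : 0 < P a0' a1' a2' b0 b1 b2) :
      x1 a0 b0 a1 b1 + x2 a0 b0 a2 b2 = x1 a0' b0 a1' b1 + x2 a0' b0 a2' b2 :=
    eq_of_miH_eq_logb_card hV hY2 (hVY.trans hcard.symm) (x := (b0, b1, b2))
      (h.trans_le (measureReal_preimage_le_comp W g₂ _))
      (h'.trans_le (measureReal_preimage_le_comp W g₂ _))
  obtain ⟨a0, y, y', hne, hy, hy'⟩ :=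
    exists_ne_of_cmiH_pos (hU1.prodMk hU2) hY1 hU0 (hpos ▸ one_pos)
  obtain ⟨ω, hω, hPω⟩ := exists_mem_measureReal_preimage_pos W hy
  obtain ⟨ω', hω', hPω'⟩ := exists_mem_measureReal_preimage_pos W hy'
  obtain ⟨rfl, rfl⟩ := Prod.mk.inj hω
  obtain ⟨rfl, h0⟩ := Prod.mk.inj hω'
  change 0 < P (U0 ω') (U1 ω') (U2 ω') (V0 ω') (V1 ω') (V2 ω') at hPω'
  rw [h0] at hPω' hne
  have hmix := indep hPω hPω'
  have hswap := detV (condIndep hmix hPω') hPω'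
  exact hne ((detU hPω hmix).trans (add_right_cancel hswap))
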